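/- Let r ≥ 1 and let W be a closed subspace of K with S(W) ⊆ W, K_r ⊆ W ⊆ K_{-r}, and dim_ℂ(W ⧸ K_r) = 2r (i.e. W ∈ F_{2r}), and suppose dim_ℂ(W ∩ K₋) > 0. Then the ℂ-linear span in ℂ² of the set {x(-1) ∣ x ∈ W, x(-1) ≠ 0, and x(n) = 0 for all n ≥ 0} (the leading coefficients of the elements of W of degree -1) is a one-dimensional subspace of ℂ². -/

import Mathlib

noncomputable section

/-- The Hilbert space `K = ℓ²(ℤ, ℂ²)`, the model of `L²(S¹) ⊗ ℂ²`. -/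
abbrev KSp := lp (fun _ : ℤ => EuclideanSpace ℂ (Fin 2)) 2

/-- The closed subspace `K_k = {x ∈ K ∣ x n = 0 for all n < k}`, the model of `z^k K₊`. -/
def Ksub (k : ℤ) : Submodule ℂ KSp where
  carrier := {x : KSp | ∀ n : ℤ, n < k → x n = 0}
  add_mem' := by
    intro a b ha hb n hn
    simp only [Set.mem_setOf_eq] at ha hb
    simp [lp.coeFn_add, Pi.add_apply, ha n hn, hb n hn]
  zero_mem' := by
    intro n hn
    simp [lp.coeFn_zero]
  smul_mem' := by
    intro c a ha n hn
    simp only [Set.mem_setOf_eq] at ha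
    simp [lp.coeFn_smul, Pi.smul_apply, ha n hn]

/-- The closed subspace `K₋ = {x ∈ K ∣ x n = 0 for all n ≥ 0}`. -/
def Kneg : Submodule ℂ KSp where
  carrier := {x : KSp | ∀ n : ℤ, 0 ≤ n → x n = 0}
  add_mem' := by
    intro a b ha hb n hn
    simp only [Set.mem_setOf_eq] at ha hb
    simp [lp.coeFn_add, Pi.add_apply, ha n hn, hb n hn]
  zero_mem' := by
    intro n hn
    simp [lp.coeFn_zero]
  smul_mem' := by
    intro c a ha n hn
    simp only [Set.mem_setOf_eq] at ha
    simp [lp.coeFn_smul, Pi.smul_apply, ha n hn]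

theorem shift_iter (S : KSp ≃ₗᵢ[ℂ] KSp) (hS : ∀ (x : KSp) (n : ℤ), (S x) n = x (n - 1))
    (k : ℕ) (x : KSp) (n : ℤ) : (S^[k] x) n = x (n - k) := by
  induction k generalizing n with
  | zero => simp
  | succ k ih =>
    rw [Function.iterate_succ_apply', hS, ih, show n - 1 - (k : ℤ) = n - ((k + 1 : ℕ) : ℤ) by push_cast; ring]

theorem shift_iter_mem (S : KSp ≃ₗᵢ[ℂ] KSp) (W : Submodule ℂ KSp)
    (hSW : ∀ x ∈ W, S x ∈ W) (k : ℕ) (x : KSp) (hx : x ∈ W) : S^[k] x ∈ W := by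
  induction k with
  | zero => simpa
  | succ k ih =>
    rw [Function.iterate_succ_apply']
    exact hSW _ ih

/-- Evaluation at an index, as a linear map. -/
def evalLin (n : ℤ) : KSp →ₗ[ℂ] EuclideanSpace ℂ (Fin 2) where
  toFun x := x n
  map_add' x y := by simp [lp.coeFn_add]
  map_smul' c x := by simp [lp.coeFn_smul]

theorem surj_aux (r : ℕ)
    (S : KSp ≃ₗᵢ[ℂ] KSp) (hS : ∀ (x : KSp) (n : ℤ), (S x) n = x (n - 1))
    (W : Submodule ℂ KSp) (hSW : ∀ x ∈ W, S x ∈ W)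
    (h : ∀ v : EuclideanSpace ℂ (Fin 2), ∃ x ∈ W, (∀ n : ℤ, 0 ≤ n → x n = 0) ∧ x (-1 : ℤ) = v)
    (f : ℤ → EuclideanSpace ℂ (Fin 2)) (m : ℕ) (hm : m ≤ r + 1) :
    ∃ w ∈ W, ∀ n : ℤ, (r : ℤ) - m ≤ n → n < r → w n = f n := by
  induction m with
  | zero => exact ⟨0, W.zero_mem, fun n h1 h2 => by simp at h1; omega⟩
  | succ m ih =>
    obtain ⟨w, hw, hwf⟩ := ih (by omega)
    obtain ⟨y, hy, hy0, hy1⟩ := h (f ((r : ℤ) - m - 1) - w ((r : ℤ) - m - 1))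
    refine ⟨w + S^[r - m] y, W.add_mem hw (shift_iter_mem S W hSW _ _ hy), fun n h1 h2 => ?_⟩
    rw [lp.coeFn_add, Pi.add_apply, shift_iter S hS]
    push_cast at h1
    have hc : ((r - m : ℕ) : ℤ) = (r : ℤ) - m := by omega
    rw [hc]
    by_cases hn : n = (r : ℤ) - m - 1
    · subst hn
      rw [show (r : ℤ) - m - 1 - (r - m) = -1 by ring, hy1]
      abel
    · rw [hy0 _ (by omega), hwf n (by omega) h2, add_zero]

/-- For `W ∈ F_{2r}` (with `r ≥ 1`) of positive rank, the span in `ℂ²` of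
the leading coefficients of the elements of `W` of degree `-1` is one-dimensional. -/
theorem finrank_span_leading_coefficients_eq_one
    (r : ℕ) (hr : 1 ≤ r)
    (S : KSp ≃ₗᵢ[ℂ] KSp) (hS : ∀ (x : KSp) (n : ℤ), (S x) n = x (n - 1))
    (W : Submodule ℂ KSp) (hWclosed : IsClosed (W : Set KSp))
    (hSW : ∀ x ∈ W, S x ∈ W)
    (hlow : Ksub (r : ℤ) ≤ W) (hhigh : W ≤ Ksub (-(r : ℤ)))
    (hdim : Module.finrank ℂ (↥W ⧸ (Ksub (r : ℤ)).comap W.subtype) = 2 * r)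
    (hrank : 0 < Module.finrank ℂ ↥(W ⊓ Kneg)) :
    Module.finrank ℂ
      ↥(Submodule.span ℂ {v : EuclideanSpace ℂ (Fin 2) | ∃ x : KSp, x ∈ W ∧
          x (-1 : ℤ) ≠ 0 ∧ (∀ n : ℤ, 0 ≤ n → x n = 0) ∧ v = x (-1 : ℤ)}) = 1 := by
  set A := {v : EuclideanSpace ℂ (Fin 2) | ∃ x : KSp, x ∈ W ∧
          x (-1 : ℤ) ≠ 0 ∧ (∀ n : ℤ, 0 ≤ n → x n = 0) ∧ v = x (-1 : ℤ)} with hA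
  have hle : Module.finrank ℂ (Submodule.span ℂ A) ≤ 2 := by
    simpa using Submodule.finrank_le (Submodule.span ℂ A)
  -- the span is nonzero
  have hpos : 0 < Module.finrank ℂ (Submodule.span ℂ A) := by
    have : Nontrivial ↥(W ⊓ Kneg) := Module.nontrivial_of_finrank_pos hrank
    obtain ⟨⟨x, hxW, hxN⟩, hx⟩ := exists_ne (0 : ↥(W ⊓ Kneg))
    have hxN' : ∀ n : ℤ, 0 ≤ n → x n = 0 := hxN
    have hx0 : ∃ n : ℤ, x n ≠ 0 := by
      by_contra! hc
      apply hx
      apply Subtype.ext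
      apply lp.ext
      funext n
      simpa using hc n
    obtain ⟨d, hd, hdm⟩ := Int.exists_greatest_of_bdd (P := fun n : ℤ => x n ≠ 0)
      ⟨0, fun z hz => by
        by_contra! hc
        exact hz (hxN' z hc.le)⟩ hx0
    have hd0 : d < 0 := by
      by_contra! hc
      exact hd (hxN' d hc)
    have hmem : x d ∈ A := by
      have hc : (((-1 - d).toNat : ℕ) : ℤ) = -1 - d := by omega
      have e : (S^[(-1 - d).toNat] x) (-1 : ℤ) = x d := by
        rw [shift_iter S hS, hc, show (-1 : ℤ) - (-1 - d) = d by ring]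
      refine ⟨S^[(-1 - d).toNat] x, shift_iter_mem S W hSW _ _ hxW, ?_, fun n hn => ?_, e.symm⟩
      · rw [e]
        exact hd
      · rw [shift_iter S hS, hc]
        by_contra hne
        have := hdm _ hne
        omega
    have : Nontrivial (Submodule.span ℂ A) :=
      ⟨⟨⟨x d, Submodule.subset_span hmem⟩, 0, fun h => hd (congrArg Subtype.val h)⟩⟩
    exact Module.finrank_pos
  -- the span is not everything
  have hne : Module.finrank ℂ (Submodule.span ℂ A) ≠ 2 := by
    intro h2
    have htop : Submodule.span ℂ A = ⊤ := Submodule.eq_top_of_finrank_eq (by simpa using h2)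
    have hAL : Submodule.span ℂ A ≤ (W ⊓ Kneg).map (evalLin (-1)) := by
      rw [Submodule.span_le]
      rintro v ⟨x, hxW, -, hxN, rfl⟩
      exact ⟨x, ⟨hxW, hxN⟩, rfl⟩
    have h : ∀ v : EuclideanSpace ℂ (Fin 2),
        ∃ x ∈ W, (∀ n : ℤ, 0 ≤ n → x n = 0) ∧ x (-1 : ℤ) = v := by
      intro v
      obtain ⟨x, ⟨hxW, hxN⟩, hx⟩ := hAL (show v ∈ Submodule.span ℂ A by rw [htop]; trivial)
      exact ⟨x, hxW, hxN, hx⟩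
    have hfin : Module.Finite ℂ (↥W ⧸ (Ksub (r : ℤ)).comap W.subtype) :=
      Module.finite_of_finrank_pos (by omega)
    let T : ↥W →ₗ[ℂ] (Fin (r + 1) → EuclideanSpace ℂ (Fin 2)) :=
      LinearMap.pi fun j => (evalLin ((j : ℕ) - 1 : ℤ)).comp W.subtype
    have hT : (Ksub (r : ℤ)).comap W.subtype ≤ LinearMap.ker T := by
      intro x hx
      rw [LinearMap.mem_ker]
      funext j
      have hx' : ∀ n : ℤ, n < r → (x : KSp) n = 0 := hx
      exact hx' _ (by omega)
    let T' := ((Ksub (r : ℤ)).comap W.subtype).liftQ T hT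
    have hsurj : Function.Surjective T' := by
      intro f
      obtain ⟨w, hw, hwf⟩ := surj_aux r S hS W hSW h
        (fun n => if hn : (n + 1).toNat < r + 1 then f ⟨(n + 1).toNat, hn⟩ else 0) (r + 1) le_rfl
      refine ⟨Submodule.Quotient.mk ⟨w, hw⟩, ?_⟩
      funext j
      have := hwf ((j : ℕ) - 1 : ℤ) (by push_cast; omega) (by omega)
      change w ((j : ℕ) - 1 : ℤ) = f j
      rw [this]
      simp
      intro hj
      omega
    have := LinearMap.finrank_le_finrank_of_surjective hsurj
    rw [hdim, Module.finrank_pi_fintype] at this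
    simp at this
    omega
  omega


end
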